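/- Let A ∈ {0,1}^{n×n} and let l, p, r > 1 be integers with n = lpr. Then A admits both an (l, pr) factorization and a (pl, r) factorization if and only if A admits an (l, p, r) factorization, i.e., A = A₁ ⊗ P ⊗ A₂ with A₁ ∈ {0,1}^{l×l}, P ∈ {0,1}^{p×p}, A₂ ∈ {0,1}^{r×r}. -/

import Mathlib

namespace KronPaper

/-- Kronecker product of square binary (Bool-valued) matrices. -/
def kron {m n : ℕ} (A : Matrix (Fin m) (Fin m) Bool) (B : Matrix (Fin n) (Fin n) Bool) :
    Matrix (Fin (m * n)) (Fin (m * n)) Bool :=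
  Matrix.of fun i j => by
    have hn : 0 < n := by
      rcases Nat.eq_zero_or_pos n with h | h
      · exact absurd i.isLt (by simp [h])
      · exact h
    exact
      A ⟨i.val / n, Nat.div_lt_of_lt_mul (lt_of_lt_of_eq i.isLt (mul_comm m n))⟩
        ⟨j.val / n, Nat.div_lt_of_lt_mul (lt_of_lt_of_eq j.isLt (mul_comm m n))⟩
      && B ⟨i.val % n, Nat.mod_lt _ hn⟩ ⟨j.val % n, Nat.mod_lt _ hn⟩

/-- Cast a square matrix along an equality of sizes. -/
def castK {m n : ℕ} (h : m = n) (M : Matrix (Fin m) (Fin m) Bool) :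
    Matrix (Fin n) (Fin n) Bool :=
  Matrix.reindex (finCongr h) (finCongr h) M

/-- Iterated Kronecker product of a list of square binary matrices. -/
def kronList : (ns : List ℕ) →
    ((i : Fin ns.length) → Matrix (Fin (ns.get i)) (Fin (ns.get i)) Bool) →
    Matrix (Fin ns.prod) (Fin ns.prod) Bool
  | [], _ => Matrix.of fun _ _ => true
  | _ :: ns, F => kron (F ⟨0, Nat.succ_pos _⟩) (kronList ns fun i => F i.succ)


/-- Square binary matrices of size `n`. -/
abbrev BMat (n : ℕ) := Matrix (Fin n) (Fin n) Bool

theorem kron_finProdFinEquiv {m n : ℕ} (A : BMat m) (B : BMat n) (i j : Fin m × Fin n) :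
    kron A B (finProdFinEquiv i) (finProdFinEquiv j) = (A i.1 j.1 && B i.2 j.2) := by
  have key : ∀ k : Fin m × Fin n, ((finProdFinEquiv k : Fin (m * n)) : ℕ) / n = k.1 ∧
      ((finProdFinEquiv k : Fin (m * n)) : ℕ) % n = k.2 := by
    intro k
    have hn : 0 < n := k.2.pos
    constructor
    · simp [Nat.add_mul_div_left _ _ hn, Nat.div_eq_of_lt k.2.isLt]
    · simp [Nat.mod_eq_of_lt k.2.isLt]
  simp only [kron, Matrix.of_apply, (key _).1, (key _).2]

theorem castK_finCongr {m n : ℕ} (h : m = n) (M : BMat m) (i j : Fin m) :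
    castK h M (finCongr h i) (finCongr h j) = M i j := by
  subst h
  rfl

theorem castK_castK {m n k : ℕ} (h : m = n) (h' : n = k) (M : BMat m) :
    castK h' (castK h M) = castK (h.trans h') M := by
  subst h h'
  rfl

theorem kron_castK_left {m m' n : ℕ} (h : m = m') (A : BMat m) (B : BMat n) :
    kron (castK h A) B = castK (congrArg (· * n) h) (kron A B) := by
  subst h
  rfl

/-- Two square matrices of size `l * p * r` agree if they agree at all triple indices. -/
theorem ext_triple {l p r : ℕ} {M N : BMat (l * p * r)}
    (h : ∀ (a a' : Fin l) (b b' : Fin p) (c c' : Fin r),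
      M (finProdFinEquiv (finProdFinEquiv (a, b), c))
          (finProdFinEquiv (finProdFinEquiv (a', b'), c')) =
        N (finProdFinEquiv (finProdFinEquiv (a, b), c))
          (finProdFinEquiv (finProdFinEquiv (a', b'), c'))) : M = N := by
  ext i j
  obtain ⟨⟨ab, c⟩, rfl⟩ := finProdFinEquiv.surjective i
  obtain ⟨⟨a, b⟩, rfl⟩ := finProdFinEquiv.surjective ab
  obtain ⟨⟨ab', c'⟩, rfl⟩ := finProdFinEquiv.surjective j
  obtain ⟨⟨a', b'⟩, rfl⟩ := finProdFinEquiv.surjective ab'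
  exact h a a' b b' c c'

theorem finProdFinEquiv_assoc {l p r : ℕ} (a : Fin l) (b : Fin p) (c : Fin r) :
    finProdFinEquiv (finProdFinEquiv (a, b), c) =
      finCongr (mul_assoc l p r).symm (finProdFinEquiv (a, finProdFinEquiv (b, c))) := by
  ext
  simp
  ring

theorem castK_kron_triple {l p r : ℕ} (A : BMat l) (B : BMat (p * r))
    (a a' : Fin l) (b b' : Fin p) (c c' : Fin r) :
    castK (mul_assoc l p r).symm (kron A B) (finProdFinEquiv (finProdFinEquiv (a, b), c))
        (finProdFinEquiv (finProdFinEquiv (a', b'), c')) =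
      (A a a' && B (finProdFinEquiv (b, c)) (finProdFinEquiv (b', c'))) := by
  rw [finProdFinEquiv_assoc, finProdFinEquiv_assoc, castK_finCongr, kron_finProdFinEquiv]

theorem kron_assoc {l p r : ℕ} (L : BMat l) (P : BMat p) (R : BMat r) :
    kron (kron L P) R = castK (mul_assoc l p r).symm (kron L (kron P R)) := by
  refine ext_triple fun a a' b b' c c' => ?_
  rw [castK_kron_triple]
  simp only [kron_finProdFinEquiv, Bool.and_assoc]

/-- A Boolean function of three variables that splits off its first variable and also its last
variable is a product of three functions of one variable each. -/
theorem exists_and_and_of_and_eq_and {α β γ : Type*} {X : α → Bool} {Y : β → γ → Bool}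
    {U : α → β → Bool} {V : γ → Bool} (h : ∀ a b c, (X a && Y b c) = (U a b && V c)) :
    ∃ (x : α → Bool) (y : β → Bool) (z : γ → Bool),
      ∀ a b c, (X a && Y b c) = (x a && y b && z c) := by
  by_cases h0 : ∃ a b c, (X a && Y b c) = true
  · obtain ⟨a₀, b₀, c₀, h₀⟩ := h0
    refine ⟨X, fun b => X a₀ && Y b c₀, V, fun a b c => ?_⟩
    have h1 := h a₀ b₀ c₀
    have h2 := h a₀ b c₀
    have h3 := h a₀ b c
    have h4 := h a b c
    grind
  · push Not at h0
    exact ⟨fun _ => false, fun _ => false, fun _ => false, by simpa using h0⟩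

/-- `A` admits both an `(l, pr)` and a `(pl, r)` factorization iff it
admits an `(l, p, r)` factorization. -/
theorem two_factorizations_iff_three (l p r : ℕ) (hl : 1 < l) (hp : 1 < p) (hr : 1 < r)
    (A : BMat (l * p * r)) :
    ((∃ (A₁ : BMat l) (A₂ : BMat (p * r)), A = castK (mul_assoc l p r).symm (kron A₁ A₂)) ∧
     (∃ (B₁ : BMat (p * l)) (B₂ : BMat r),
        A = castK (show p * l * r = l * p * r by ring) (kron B₁ B₂))) ↔
      ∃ (L : BMat l) (P : BMat p) (R : BMat r), A = kron (kron L P) R := by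
  constructor
  · rintro ⟨⟨A₁, A₂, hA⟩, B₁, B₂, hB⟩
    have hB' : A = kron (castK (mul_comm p l) B₁) B₂ := by rw [kron_castK_left, hB]
    obtain ⟨x, y, z, hxyz⟩ := exists_and_and_of_and_eq_and
      (X := fun a : Fin l × Fin l => A₁ a.1 a.2)
      (Y := fun (b : Fin p × Fin p) (c : Fin r × Fin r) =>
        A₂ (finProdFinEquiv (b.1, c.1)) (finProdFinEquiv (b.2, c.2)))
      (U := fun a b => castK (mul_comm p l) B₁ (finProdFinEquiv (a.1, b.1))
        (finProdFinEquiv (a.2, b.2)))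
      (V := fun c => B₂ c.1 c.2) (fun a b c => by
        rw [← castK_kron_triple, ← hA, hB', kron_finProdFinEquiv])
    refine ⟨Matrix.of fun i j => x (i, j), Matrix.of fun i j => y (i, j),
      Matrix.of fun i j => z (i, j), ?_⟩
    refine ext_triple fun a a' b b' c c' => ?_
    rw [hA, castK_kron_triple]
    simp only [kron_finProdFinEquiv, Matrix.of_apply]
    exact hxyz (a, a') (b, b') (c, c')
  · rintro ⟨L, P, R, rfl⟩
    refine ⟨⟨L, kron P R, kron_assoc L P R⟩, castK (mul_comm l p) (kron L P), R, ?_⟩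
    rw [kron_castK_left, castK_castK]
    rfl

end KronPaper
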